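/- arXiv:2512.09467 — 3 statements merged into one kernel-verified Lean document; each statement's English description precedes it below -/
import Mathlib

section
/- Let d ≥ 1, let Σp and Σq be d×d real symmetric positive-definite matrices, and let μp, μq ∈ ℝ^d with Δ = μq − μp. Then the closed-form Cauchy–Schwarz divergence between the Gaussians N(μp, Σp) and N(μq, Σq) is bounded by the Kullback–Leibler divergence in both directions; that is, (1/2)·Δᵀ(Σp + Σq)⁻¹Δ + (1/2)·log( det(Σp + Σq) / (2^d · √(det Σp · det Σq)) ) ≤ (1/2)·( trace(Σq⁻¹Σp) − d + ΔᵀΣq⁻¹Δ + log( det Σq / det Σp ) ), and the same left-hand side is also ≤ (1/2)·( trace(Σp⁻¹Σq) − d + ΔᵀΣp⁻¹Δ + log( det Σp / det Σq ) ). -/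
open Matrix Real

theorem Matrix.PosDef.log_det_le_trace_sub_card {n : Type*} [Fintype n] [DecidableEq n]
    {A : Matrix n n ℝ} (hA : A.PosDef) :
    Real.log A.det ≤ A.trace - Fintype.card n := by
  rw [hA.1.det_eq_prod_eigenvalues, hA.1.trace_eq_sum_eigenvalues]
  simp only [RCLike.ofReal_real_eq_id, id_eq]
  rw [Real.log_prod fun i _ => (hA.eigenvalues_pos i).ne']
  calc ∑ i, Real.log (hA.1.eigenvalues i) ≤ ∑ i, (hA.1.eigenvalues i - 1) :=
        Finset.sum_le_sum fun i _ => Real.log_le_sub_one_of_pos (hA.eigenvalues_pos i)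
    _ = ∑ i, hA.1.eigenvalues i - Fintype.card n := by simp

open scoped MatrixOrder in
theorem Matrix.PosDef.log_det_sub_log_det_le {n : Type*} [Fintype n] [DecidableEq n]
    {A Q : Matrix n n ℝ} (hA : A.PosDef) (hQ : Q.PosDef) :
    Real.log A.det - Real.log Q.det ≤ (Q⁻¹ * A).trace - Fintype.card n := by
  obtain ⟨B, hB⟩ := CStarAlgebra.nonneg_iff_eq_star_mul_self.mp hQ.inv.posSemidef.nonneg
  rw [star_eq_conjTranspose] at hB
  have hBu : IsUnit B := by
    have h := hQ.inv.isUnit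
    rw [isUnit_iff_isUnit_det, hB, det_mul] at h
    exact (isUnit_iff_isUnit_det B).mpr (isUnit_of_mul_isUnit_right h)
  have hM : (B * A * Bᴴ).PosDef :=
    hA.mul_mul_conjTranspose_same (vecMul_injective_of_isUnit hBu)
  have h := hM.log_det_le_trace_sub_card
  have hdet : (B * A * Bᴴ).det = A.det / Q.det := by
    have h2 : Q⁻¹.det = Q.det⁻¹ := by rw [det_nonsing_inv, Ring.inverse_eq_inv']
    rw [div_eq_mul_inv, ← h2, hB]
    simp only [det_mul]
    ring
  rwa [hdet, Real.log_div hA.det_pos.ne' hQ.det_pos.ne', trace_mul_comm, ← mul_assoc, ← hB] at h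

theorem Matrix.PosDef.dotProduct_add_inv_mulVec_le {n : Type*} [Fintype n] [DecidableEq n]
    {P Q : Matrix n n ℝ} (hP : P.PosDef) (hQ : Q.PosDef) (v : n → ℝ) :
    v ⬝ᵥ (P + Q)⁻¹ *ᵥ v ≤ v ⬝ᵥ Q⁻¹ *ᵥ v := by
  set x := (P + Q)⁻¹ *ᵥ v with hx
  set y := Q⁻¹ *ᵥ v with hy
  have hxv : P *ᵥ x + Q *ᵥ x = v := by
    rw [← add_mulVec, hx, mulVec_mulVec,
      mul_nonsing_inv _ ((isUnit_iff_isUnit_det _).mp (hP.add hQ).isUnit), one_mulVec]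
  have hyv : Q *ᵥ y = v := by
    rw [hy, mulVec_mulVec, mul_nonsing_inv _ ((isUnit_iff_isUnit_det _).mp hQ.isUnit), one_mulVec]
  have h₁ : 0 ≤ x ⬝ᵥ P *ᵥ x := hP.posSemidef.dotProduct_mulVec_nonneg x
  have h₂ : 0 ≤ (x - y) ⬝ᵥ Q *ᵥ (x - y) := hQ.posSemidef.dotProduct_mulVec_nonneg (x - y)
  have h₃ : x ⬝ᵥ P *ᵥ x + x ⬝ᵥ Q *ᵥ x = v ⬝ᵥ x := by
    rw [← dotProduct_add, hxv, dotProduct_comm]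
  have h₄ : y ⬝ᵥ Q *ᵥ x = v ⬝ᵥ x := by
    rw [dotProduct_mulVec, ← mulVec_transpose, ← conjTranspose_eq_transpose_of_trivial,
      hQ.1.eq, hyv]
  rw [mulVec_sub, hyv, sub_dotProduct, dotProduct_sub, dotProduct_sub, h₄, dotProduct_comm x v,
    dotProduct_comm y v] at h₂
  linarith

theorem gaussian_cauchySchwarz_le_kullbackLeibler {n : Type*} [Fintype n] [DecidableEq n]
    {P Q : Matrix n n ℝ} (hP : P.PosDef) (hQ : Q.PosDef) (v : n → ℝ) :
    (1 / 2 : ℝ) * (v ⬝ᵥ (P + Q)⁻¹ *ᵥ v)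
        + 1 / 2 * Real.log ((P + Q).det / (2 ^ Fintype.card n * √(P.det * Q.det)))
      ≤ 1 / 2 * ((Q⁻¹ * P).trace - Fintype.card n + v ⬝ᵥ Q⁻¹ *ᵥ v
          + Real.log (Q.det / P.det)) := by
  have hPd := hP.det_pos
  have hQd := hQ.det_pos
  have hS : ((1 / 2 : ℝ) • (P + Q)).PosDef := (hP.add hQ).smul (by norm_num)
  have h₁ := hP.log_det_sub_log_det_le hQ
  have h₂ := hS.log_det_sub_log_det_le hQ
  have h₃ := hP.dotProduct_add_inv_mulVec_le hQ v
  have htr : (Q⁻¹ * ((1 / 2 : ℝ) • (P + Q))).trace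
      = 1 / 2 * ((Q⁻¹ * P).trace + Fintype.card n) := by
    rw [mul_smul_comm, trace_smul, mul_add,
      nonsing_inv_mul _ ((isUnit_iff_isUnit_det _).mp hQ.isUnit), trace_add, trace_one, smul_eq_mul]
  have hlog : Real.log ((1 / 2 : ℝ) • (P + Q)).det
      = Real.log (P + Q).det - Fintype.card n * Real.log 2 := by
    rw [det_smul, Real.log_mul (by positivity) (hP.add hQ).det_pos.ne', Real.log_pow,
      one_div, Real.log_inv]
    ring
  rw [htr, hlog] at h₂
  rw [Real.log_div (hP.add hQ).det_pos.ne' (by positivity), Real.log_div hQd.ne' hPd.ne',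
    Real.log_mul (by positivity) (by positivity), Real.log_pow, Real.log_sqrt (by positivity),
    Real.log_mul hPd.ne' hQd.ne']
  linarith

/-- Under a Gaussian comparison, the closed-form Cauchy–Schwarz divergence between
`N(μp, Σp)` and `N(μq, Σq)` is bounded by the Kullback–Leibler divergence in both
directions. -/
theorem cs_le_kl_gaussian (d : ℕ) (hd : 1 ≤ d)
    (Sp Sq : Matrix (Fin d) (Fin d) ℝ)
    (hp : Sp.PosDef) (hq : Sq.PosDef)
    (μp μq Δ : Fin d → ℝ) (hΔ : Δ = μq - μp) :
    ((1 : ℝ) / 2) * (Δ ⬝ᵥ ((Sp + Sq)⁻¹.mulVec Δ))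
        + (1 / 2) * Real.log ((Sp + Sq).det / (2 ^ d * Real.sqrt (Sp.det * Sq.det)))
      ≤ (1 / 2) * ((Sq⁻¹ * Sp).trace - d + Δ ⬝ᵥ (Sq⁻¹.mulVec Δ)
          + Real.log (Sq.det / Sp.det))
    ∧
    ((1 : ℝ) / 2) * (Δ ⬝ᵥ ((Sp + Sq)⁻¹.mulVec Δ))
        + (1 / 2) * Real.log ((Sp + Sq).det / (2 ^ d * Real.sqrt (Sp.det * Sq.det)))
      ≤ (1 / 2) * ((Sp⁻¹ * Sq).trace - d + Δ ⬝ᵥ (Sp⁻¹.mulVec Δ)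
          + Real.log (Sp.det / Sq.det)) := by
  have h₁ := gaussian_cauchySchwarz_le_kullbackLeibler hp hq Δ
  have h₂ := gaussian_cauchySchwarz_le_kullbackLeibler hq hp Δ
  rw [add_comm Sq Sp, mul_comm Sq.det] at h₂
  rw [Fintype.card_fin] at h₁ h₂
  exact ⟨h₁, h₂⟩
end

section
/- Define g : (0, ∞) → ℝ by g(λ) = −log 2 + log(1 + λ) + (1/2)·log λ − λ + 1. Then g(λ) ≤ 0 for all λ > 0, with equality if and only if λ = 1. -/
open Real

/-- The function `g(λ) = −log 2 + log(1+λ) + (1/2) log λ − λ + 1` is nonpositive on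
`(0, ∞)`, with equality if and only if `λ = 1`. -/
theorem g_nonpos (g : ℝ → ℝ)
    (hg : ∀ l, g l = -Real.log 2 + Real.log (1 + l) + (1 / 2) * Real.log l - l + 1) :
    ∀ l : ℝ, 0 < l → (g l ≤ 0 ∧ (g l = 0 ↔ l = 1)) := by
  intro l hl
  have hdiv : Real.log ((1 + l) / 2) = Real.log (1 + l) - Real.log 2 :=
    Real.log_div (by positivity) two_ne_zero
  have hmean : Real.log ((1 + l) / 2) ≤ (1 + l) / 2 - 1 :=
    Real.log_le_sub_one_of_pos (by positivity)
  have hlog : Real.log l ≤ l - 1 := Real.log_le_sub_one_of_pos hl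
  rw [hg]
  refine ⟨by linarith, fun h => ?_, ?_⟩
  · by_contra hne
    have hlt : Real.log l < l - 1 := Real.log_lt_sub_one_of_pos hl hne
    linarith
  · rintro rfl
    norm_num
end

section
/- Let σ > 0, d ≥ 1, and let x₁ᵖ, …, x_{N₁}ᵖ ∈ ℝ^d and x₁^q, …, x_{N₂}^q ∈ ℝ^d with the kernel density estimators p̂(x) = (1/N₁) Σ_{i=1}^{N₁} κ_σ(x, x_iᵖ) and q̂(x) = (1/N₂) Σ_{j=1}^{N₂} κ_σ(x, x_j^q). Then the Cauchy–Schwarz divergence D_CS(p̂; q̂) = −log( (∫ p̂ q̂)² / (∫ p̂² · ∫ q̂²) ) equals log( (1/N₁²) Σ_{i,j=1}^{N₁} κ_{√2·σ}(x_iᵖ, x_jᵖ) ) + log( (1/N₂²) Σ_{i,j=1}^{N₂} κ_{√2·σ}(x_i^q, x_j^q) ) − 2·log( (1/(N₁ N₂)) Σ_{i=1}^{N₁} Σ_{j=1}^{N₂} κ_{√2·σ}(x_iᵖ, x_j^q) ); in particular the constant C_σ = (π σ²)^{d/2} cancels and the empirical CS estimator depends only on the Gram sums of the kernel of bandwidth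 √2·σ. -/
open Real MeasureTheory BigOperators

/-- The Gaussian (RBF) kernel of bandwidth `σ` on `ℝ^d`. -/
noncomputable def gaussKernel (d : ℕ) (σ : ℝ) (x y : EuclideanSpace ℝ (Fin d)) : ℝ :=
  Real.exp (-‖x - y‖ ^ 2 / (2 * σ ^ 2))

/-- The parallelogram law completes the square in a product of two Gaussian kernels. -/
lemma gaussKernel_mul_gaussKernel {d : ℕ} {σ : ℝ} (hσ : σ ≠ 0)
    (x y z : EuclideanSpace ℝ (Fin d)) :
    gaussKernel d σ z x * gaussKernel d σ z y =
      gaussKernel d (√2 * σ) x y *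
        Real.exp (-(σ ^ 2)⁻¹ * ‖z - (2⁻¹ : ℝ) • (x + y)‖ ^ 2) := by
  have h := parallelogram_law_with_norm ℝ (z - x) (z - y)
  have hsum : z - x + (z - y) = (2 : ℝ) • (z - (2⁻¹ : ℝ) • (x + y)) := by module
  have hdiff : z - x - (z - y) = -(x - y) := by abel
  rw [hsum, hdiff, norm_smul, norm_neg, Real.norm_ofNat] at h
  unfold gaussKernel
  rw [← Real.exp_add, ← Real.exp_add, mul_pow, Real.sq_sqrt zero_le_two]
  congr 1
  field_simp
  linarith

lemma integrable_exp_neg_mul_sq_norm_sub {V : Type*} [NormedAddCommGroup V]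
    [InnerProductSpace ℝ V] [FiniteDimensional ℝ V] [MeasurableSpace V] [BorelSpace V]
    {b : ℝ} (hb : 0 < b) (w : V) :
    Integrable fun v : V ↦ Real.exp (-b * ‖v - w‖ ^ 2) := by
  have h : Integrable fun v : V ↦ Real.exp (-b * ‖v‖ ^ 2) := by
    refine Integrable.of_integral_ne_zero ?_
    rw [GaussianFourier.integral_rexp_neg_mul_sq_norm hb]
    positivity
  exact h.comp_sub_right w

lemma integrable_gaussKernel_mul_gaussKernel {d : ℕ} {σ : ℝ} (hσ : 0 < σ)
    (x y : EuclideanSpace ℝ (Fin d)) :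
    Integrable fun z ↦ gaussKernel d σ z x * gaussKernel d σ z y := by
  simp_rw [gaussKernel_mul_gaussKernel hσ.ne' x y]
  exact (integrable_exp_neg_mul_sq_norm_sub (by positivity) _).const_mul _

lemma integral_gaussKernel_mul_gaussKernel {d : ℕ} {σ : ℝ} (hσ : 0 < σ)
    (x y : EuclideanSpace ℝ (Fin d)) :
    ∫ z, gaussKernel d σ z x * gaussKernel d σ z y =
      (π * σ ^ 2) ^ (d / 2 : ℝ) * gaussKernel d (√2 * σ) x y := by
  simp_rw [gaussKernel_mul_gaussKernel hσ.ne' x y]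
  rw [integral_const_mul,
    integral_sub_right_eq_self (fun z ↦ Real.exp (-(σ ^ 2)⁻¹ * ‖z‖ ^ 2)),
    GaussianFourier.integral_rexp_neg_mul_sq_norm (by positivity),
    finrank_euclideanSpace_fin, div_inv_eq_mul, mul_comm]

lemma integral_sum_gaussKernel_mul_sum_gaussKernel {d : ℕ} {σ : ℝ} (hσ : 0 < σ)
    {ι κ : Type*} [Fintype ι] [Fintype κ] (a b : ℝ)
    (x : ι → EuclideanSpace ℝ (Fin d)) (y : κ → EuclideanSpace ℝ (Fin d)) :
    ∫ z, (a * ∑ i, gaussKernel d σ z (x i)) * (b * ∑ j, gaussKernel d σ z (y j)) =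
      (π * σ ^ 2) ^ (d / 2 : ℝ) *
        (a * b * ∑ i, ∑ j, gaussKernel d (√2 * σ) (x i) (y j)) := by
  have hint := fun i j ↦ integrable_gaussKernel_mul_gaussKernel hσ (x i) (y j)
  simp_rw [mul_mul_mul_comm a, Finset.sum_mul_sum]
  rw [integral_const_mul,
    integral_finsetSum _ fun i _ ↦ integrable_finsetSum _ fun j _ ↦ hint i j]
  simp_rw [integral_finsetSum _ fun j _ ↦ hint _ j,
    integral_gaussKernel_mul_gaussKernel hσ, ← Finset.mul_sum]
  ring

lemma sum_sum_gaussKernel_pos {d : ℕ} (σ : ℝ) {ι κ : Type*} [Fintype ι] [Fintype κ]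
    [Nonempty ι] [Nonempty κ]
    (x : ι → EuclideanSpace ℝ (Fin d)) (y : κ → EuclideanSpace ℝ (Fin d)) :
    0 < ∑ i, ∑ j, gaussKernel d σ (x i) (y j) :=
  Finset.sum_pos (fun _ _ ↦ Finset.sum_pos (fun _ _ ↦ Real.exp_pos _) Finset.univ_nonempty)
    Finset.univ_nonempty

/-- The Cauchy–Schwarz divergence between two Gaussian kernel density estimators equals
the empirical CS estimator built from the Gram sums of the kernel of bandwidth `√2·σ`;
in particular the constant `C_σ = (π σ²)^{d/2}` cancels. -/
theorem cs_divergence_kde (σ : ℝ) (hσ : 0 < σ) (d N₁ N₂ : ℕ)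
    (hd : 1 ≤ d) (hN₁ : 1 ≤ N₁) (hN₂ : 1 ≤ N₂)
    (xp : Fin N₁ → EuclideanSpace ℝ (Fin d))
    (xq : Fin N₂ → EuclideanSpace ℝ (Fin d))
    (phat qhat : EuclideanSpace ℝ (Fin d) → ℝ)
    (hphat : ∀ x, phat x = (1 / (N₁ : ℝ)) * ∑ i, gaussKernel d σ x (xp i))
    (hqhat : ∀ x, qhat x = (1 / (N₂ : ℝ)) * ∑ j, gaussKernel d σ x (xq j)) :
    -Real.log ((∫ x : EuclideanSpace ℝ (Fin d), phat x * qhat x) ^ 2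
        / ((∫ x : EuclideanSpace ℝ (Fin d), (phat x) ^ 2)
            * (∫ x : EuclideanSpace ℝ (Fin d), (qhat x) ^ 2)))
      = Real.log ((1 / (N₁ : ℝ) ^ 2)
            * ∑ i, ∑ j, gaussKernel d (Real.sqrt 2 * σ) (xp i) (xp j))
        + Real.log ((1 / (N₂ : ℝ) ^ 2)
            * ∑ i, ∑ j, gaussKernel d (Real.sqrt 2 * σ) (xq i) (xq j))
        - 2 * Real.log ((1 / ((N₁ : ℝ) * (N₂ : ℝ)))
            * ∑ i, ∑ j, gaussKernel d (Real.sqrt 2 * σ) (xp i) (xq j)) := by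
  have : NeZero N₁ := ⟨by lia⟩
  have : NeZero N₂ := ⟨by lia⟩
  have hN₁' : (0 : ℝ) < N₁ := by exact_mod_cast hN₁
  have hN₂' : (0 : ℝ) < N₂ := by exact_mod_cast hN₂
  have hPP := sum_sum_gaussKernel_pos (√2 * σ) xp xp
  have hQQ := sum_sum_gaussKernel_pos (√2 * σ) xq xq
  have hPQ := sum_sum_gaussKernel_pos (√2 * σ) xp xq
  have hC : 0 < (π * σ ^ 2) ^ (d / 2 : ℝ) := by positivity
  simp_rw [sq (phat _), sq (qhat _), hphat, hqhat,
    integral_sum_gaussKernel_mul_sum_gaussKernel hσ, one_div_mul_one_div, ← sq (N₁ : ℝ),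
    ← sq (N₂ : ℝ)]
  rw [mul_pow, mul_mul_mul_comm, ← sq, mul_div_mul_left _ _ (by positivity),
    Real.log_div (by positivity) (by positivity), Real.log_pow,
    Real.log_mul (x := 1 / (N₁ : ℝ) ^ 2 * _) (by positivity) (by positivity)]
  push_cast
  ring
end
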